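/- arXiv:2402.10396 — 5 statements merged into one kernel-verified Lean document; each statement's English description precedes it below -/
import Mathlib

section
/- Problem (RQP2) relaxes the linearized constraints at least as much as problem (RQP1): if (d, ξ) ∈ ℝ^n × ℝ is feasible for (RQP1), i.e. A_h d + h − ξ·h = 0, A_g d + g − ξ·C g ≥ 0 componentwise, and 0 ≤ ξ ≤ 1 (where C is the diagonal matrix with C_{jj} = 1 if g_j ≤ 0 and C_{jj} = 0 otherwise), then setting s = ξ·h⁺, t = ξ·h⁻ and v = −ξ·C g makes (d, s, t, v) feasible for (RQP2), i.e. A_h d + h = s − t, A_g d + g ≥ −v componentwise, and s, t, v ≥ 0 componentwise. In particular, the projection onto the d-variables of the feasible set of (RQP2) contains that of (RQP1). -/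
/-- (RQP2) relaxes the linearized constraints at least as much as (RQP1):
any point `(d, ξ)` feasible for (RQP1) yields, via `s = ξ·h⁺`, `t = ξ·h⁻`,
`v = −ξ·C g`, a point `(d, s, t, v)` feasible for (RQP2). -/
theorem rqp2_relaxes_rqp1 (n mE mI : ℕ)
    (Ah : Matrix (Fin mE) (Fin n) ℝ) (Ag : Matrix (Fin mI) (Fin n) ℝ)
    (h : Fin mE → ℝ) (g : Fin mI → ℝ)
    (C : Matrix (Fin mI) (Fin mI) ℝ)
    (hC : C = Matrix.diagonal (fun j => if g j ≤ 0 then (1 : ℝ) else 0))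
    (d : Fin n → ℝ) (ξ : ℝ)
    (hfeas_eq : Ah.mulVec d + h - ξ • h = 0)
    (hfeas_ineq : ∀ j, 0 ≤ (Ag.mulVec d + g - ξ • C.mulVec g) j)
    (hξ0 : 0 ≤ ξ) (hξ1 : ξ ≤ 1)
    (s t : Fin mE → ℝ) (v : Fin mI → ℝ)
    (hs : s = fun j => ξ * max (h j) 0)
    (ht : t = fun j => ξ * max (-h j) 0)
    (hv : v = -ξ • C.mulVec g) :
    Ah.mulVec d + h = s - t ∧
    (∀ j, (Ag.mulVec d + g) j ≥ -v j) ∧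
    (∀ j, s j ≥ 0) ∧ (∀ j, t j ≥ 0) ∧ (∀ j, v j ≥ 0) := by
  subst hs ht hv
  refine ⟨?_, ?_, ?_, ?_, ?_⟩
  · funext j
    have h1 := congrFun hfeas_eq j
    simp only [Pi.add_apply, Pi.sub_apply, Pi.smul_apply, smul_eq_mul, Pi.zero_apply] at h1 ⊢
    have h2 : max (h j) 0 - max (-h j) 0 = h j := by
      rcases le_total (h j) 0 with h3 | h3
      · rw [max_eq_right h3, max_eq_left (by linarith)]; ring
      · rw [max_eq_left h3, max_eq_right (by linarith)]; ring
    rw [← mul_sub, h2]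
    linarith
  · intro j
    have h1 := hfeas_ineq j
    simp only [Pi.add_apply, Pi.sub_apply, Pi.smul_apply, smul_eq_mul] at h1 ⊢
    linarith
  · intro j
    exact mul_nonneg hξ0 (le_max_right _ _)
  · intro j
    exact mul_nonneg hξ0 (le_max_right _ _)
  · intro j
    subst hC
    simp only [Pi.smul_apply, smul_eq_mul, Matrix.mulVec_diagonal]
    split_ifs with h3
    · nlinarith
    · simp
end

section
/- One-sided directional derivative of the absolute value of a linearized-feasible equality constraint: let h : ℝ^n → ℝ be differentiable at x ∈ ℝ^n with gradient ∇h(x), and let d ∈ ℝ^n satisfy ∇h(x)ᵀd + h(x) = 0. Then the one-sided limit lim_{t→0⁺} (|h(x + t d)| − |h(x)|)/t exists and equals −|h(x)|. -/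
open Filter Topology

/-- One-sided directional derivative of the absolute value of an equality
constraint whose linearization is satisfied by the direction `d`:
the limit of `(|h(x + t d)| − |h(x)|)/t` as `t → 0⁺` is `−|h(x)|`. -/
theorem abs_constraint_dirDeriv (n : ℕ)
    (h : (Fin n → ℝ) → ℝ) (x d : Fin n → ℝ)
    (L : (Fin n → ℝ) →L[ℝ] ℝ) (hdiff : HasFDerivAt h L x)
    (hlin : L d + h x = 0) :
    Tendsto (fun t : ℝ => (|h (x + t • d)| - |h x|) / t)
      (𝓝[>] (0 : ℝ)) (𝓝 (-|h x|)) := by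
  have h1 : Tendsto (fun t : ℝ => t⁻¹ • (h (x + t • d) - h x)) (𝓝[>] (0 : ℝ)) (𝓝 (L d)) :=
    (hdiff.hasLineDerivAt d).tendsto_slope_zero_right
  have h2 : Tendsto (fun t : ℝ => |t⁻¹ • (h (x + t • d) - h x) + h x|) (𝓝[>] (0 : ℝ)) (𝓝 0) := by
    have := (h1.add_const (h x)).abs
    rwa [hlin, abs_zero] at this
  rw [tendsto_iff_dist_tendsto_zero]
  refine squeeze_zero' (Eventually.of_forall fun t => dist_nonneg) ?_ h2
  filter_upwards [Ioo_mem_nhdsGT (zero_lt_one : (0 : ℝ) < 1)] with t ht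
  obtain ⟨ht0, ht1⟩ := ht
  rw [Real.dist_eq]
  have e1 : (|h (x + t • d)| - |h x|) / t - -|h x|
      = (|h (x + t • d)| - |(1 - t) * h x|) / t := by
    rw [abs_mul, abs_of_pos (by linarith : (0 : ℝ) < 1 - t)]
    field_simp
    ring
  have e2 : t⁻¹ • (h (x + t • d) - h x) + h x = (h (x + t • d) - (1 - t) * h x) / t := by
    rw [smul_eq_mul]
    field_simp
    ring
  rw [e1, e2, abs_div, abs_div]
  exact div_le_div_of_nonneg_right
    (abs_abs_sub_abs_le (h (x + t • d)) ((1 - t) * h x)) (abs_nonneg t)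
end

section
/- One-sided directional derivative of the constraint-violation of a linearized-feasible inequality constraint: let g : ℝ^n → ℝ be differentiable at x ∈ ℝ^n with gradient ∇g(x), let g⁻(y) := max(0, −g(y)), and let d ∈ ℝ^n satisfy ∇g(x)ᵀd + g(x) ≥ 0. Then the one-sided limit lim_{t→0⁺} (g⁻(x + t d) − g⁻(x))/t exists and is less than or equal to −g⁻(x). -/
open Filter Topology

/-- One-sided directional derivative of the violation `g⁻ = max(0, −g)` of an
inequality constraint whose linearization is satisfied by the direction `d`:
the limit of `(g⁻(x + t d) − g⁻(x))/t` as `t → 0⁺` exists and is `≤ −g⁻(x)`. -/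
theorem ineq_violation_dirDeriv (n : ℕ)
    (g : (Fin n → ℝ) → ℝ) (x d : Fin n → ℝ)
    (L : (Fin n → ℝ) →L[ℝ] ℝ) (hdiff : HasFDerivAt g L x)
    (hlin : L d + g x ≥ 0) :
    ∃ ℓ : ℝ,
      Tendsto (fun t : ℝ => (max 0 (-g (x + t • d)) - max 0 (-g x)) / t)
        (𝓝[>] (0 : ℝ)) (𝓝 ℓ) ∧
      ℓ ≤ -max 0 (-g x) := by
  have hq : Tendsto (fun t : ℝ => (g (x + t • d) - g x) / t) (𝓝[>] (0 : ℝ)) (𝓝 (L d)) := by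
    have h := (hdiff.hasLineDerivAt d).tendsto_slope_zero_right
    refine h.congr fun t => ?_
    rw [smul_eq_mul, div_eq_inv_mul]
  have hc : Tendsto (fun t : ℝ => g (x + t • d)) (𝓝[>] (0 : ℝ)) (𝓝 (g x)) := by
    have h1 : Tendsto (fun t : ℝ => x + t • d) (𝓝 (0 : ℝ)) (𝓝 x) := by
      have : Continuous (fun t : ℝ => x + t • d) := by fun_prop
      simpa using this.tendsto 0
    exact (hdiff.continuousAt.tendsto.comp h1).mono_left nhdsWithin_le_nhds
  rcases lt_trichotomy (g x) 0 with h | h | h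
  · refine ⟨-(L d), ?_, ?_⟩
    · refine hq.neg.congr' ?_
      filter_upwards [hc.eventually_lt_const h] with t ht
      rw [max_eq_right (by linarith), max_eq_right (by linarith)]
      ring
    · rw [max_eq_right (by linarith)]
      linarith
  · refine ⟨0, ?_, by simp [h]⟩
    have hm : Tendsto (fun t : ℝ => max 0 (-((g (x + t • d) - g x) / t)))
        (𝓝[>] (0 : ℝ)) (𝓝 (max 0 (-(L d)))) := tendsto_const_nhds.max hq.neg
    rw [max_eq_left (by linarith)] at hm
    refine hm.congr' ?_
    filter_upwards [self_mem_nhdsWithin] with t ht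
    have ht' : (0 : ℝ) < t := ht
    rw [h, neg_zero, max_self, sub_zero, sub_zero, ← max_div_div_right ht'.le, zero_div,
      neg_div]
  · refine ⟨0, ?_, ?_⟩
    · refine tendsto_const_nhds.congr' ?_
      filter_upwards [hc.eventually_const_lt h] with t ht
      rw [max_eq_left (by linarith), max_eq_left (by linarith)]
      simp
    · rw [max_eq_left (by linarith)]
      simp
end

section
/- Directional derivative formula for the L1 merit function (Eq. (4)): let f : ℝ^n → ℝ and h_j : ℝ^n → ℝ (j = 1,…,m_E), g_j : ℝ^n → ℝ (j = 1,…,m_I) be differentiable at x ∈ ℝ^n, let ρ_j ≥ 0 and v_j ≥ 0 be penalty parameters, and define the L1 merit function φ(y) = f(y) + Σ_{j=1}^{m_E} ρ_j |h_j(y)| + Σ_{j=1}^{m_I} v_j max(0, −g_j(y)). If the direction d ∈ ℝ^n satisfies the linearized constraints ∇h_j(x)ᵀd + h_j(x) = 0 for all j and ∇g_j(x)ᵀd + g_j(x) ≥ 0 for all j, then the one-sided limit lim_{t→0⁺} (φ(x + t d) − φ(x))/t exists and is less than or equal to ∇f(x)ᵀd − Σ_{j=1}^{m_E} ρ_j |h_j(x)|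 − Σ_{j=1}^{m_I} v_j max(0, −g_j(x)). -/
open Filter Topology

theorem pos_part_aux (u : ℝ → ℝ) (a : ℝ) (hu : HasDerivAt u a 0) (ha : a ≤ -u 0) :
    ∃ ℓ : ℝ, Tendsto (fun t : ℝ => (max 0 (u t) - max 0 (u 0)) / t) (𝓝[>] (0 : ℝ)) (𝓝 ℓ) ∧
      ℓ ≤ -max 0 (u 0) := by
  have hs : Tendsto (fun t : ℝ => (u t - u 0) / t) (𝓝[>] (0 : ℝ)) (𝓝 a) := by
    have := hu.tendsto_slope_zero_right
    refine this.congr fun t => ?_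
    simp [div_eq_inv_mul]
  have hc : Tendsto u (𝓝[>] (0 : ℝ)) (𝓝 (u 0)) :=
    hu.continuousAt.tendsto.mono_left nhdsWithin_le_nhds
  rcases lt_trichotomy (u 0) 0 with h0 | h0 | h0
  · refine ⟨0, ?_, by rw [max_eq_left h0.le]; simp⟩
    refine tendsto_const_nhds.congr' ?_
    filter_upwards [hc.eventually (gt_mem_nhds h0)] with t ht
    rw [max_eq_left h0.le, max_eq_left (le_of_lt ht)]; simp
  · refine ⟨max 0 a, ?_, ?_⟩
    · refine (tendsto_const_nhds.max hs).congr' ?_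
      filter_upwards [self_mem_nhdsWithin] with t ht
      have ht : (0 : ℝ) < t := ht
      rw [h0]
      simp only [sub_zero, max_self]
      rw [← max_div_div_right ht.le, zero_div]
    · rw [h0] at ha ⊢
      simpa using ha
  · refine ⟨a, ?_, by rwa [max_eq_right h0.le]⟩
    refine hs.congr' ?_
    filter_upwards [hc.eventually (lt_mem_nhds h0)] with t ht
    rw [max_eq_right h0.le, max_eq_right (le_of_lt ht)]

theorem line_aux {n : ℕ} {F : (Fin n → ℝ) → ℝ} {L : (Fin n → ℝ) →L[ℝ] ℝ} {x : Fin n → ℝ}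
    (hF : HasFDerivAt F L x) (d : Fin n → ℝ) :
    HasDerivAt (fun t : ℝ => F (x + t • d)) (L d) 0 :=
  hF.hasLineDerivAt d

theorem abs_eq_aux (a : ℝ) : |a| = max 0 a + max 0 (-a) := by
  rcases le_total 0 a with h | h
  · rw [abs_of_nonneg h, max_eq_right h, max_eq_left (by linarith)]; ring
  · rw [abs_of_nonpos h, max_eq_left h, max_eq_right (by linarith)]; ring

/-- Directional derivative bound for the L1 merit function (Eq. (4)): along a
direction `d` satisfying the linearized constraints, the one-sided directional
derivative of `φ` exists and is at most
`∇f(x)ᵀd − Σ ρⱼ|hⱼ(x)| − Σ vⱼ max(0, −gⱼ(x))`. -/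
theorem l1_merit_dirDeriv (n mE mI : ℕ)
    (f : (Fin n → ℝ) → ℝ) (h : Fin mE → (Fin n → ℝ) → ℝ)
    (g : Fin mI → (Fin n → ℝ) → ℝ)
    (x d : Fin n → ℝ)
    (Lf : (Fin n → ℝ) →L[ℝ] ℝ) (Lh : Fin mE → ((Fin n → ℝ) →L[ℝ] ℝ))
    (Lg : Fin mI → ((Fin n → ℝ) →L[ℝ] ℝ))
    (hf : HasFDerivAt f Lf x)
    (hh : ∀ j, HasFDerivAt (h j) (Lh j) x)
    (hg : ∀ j, HasFDerivAt (g j) (Lg j) x)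
    (ρ : Fin mE → ℝ) (v : Fin mI → ℝ)
    (hρ : ∀ j, 0 ≤ ρ j) (hv : ∀ j, 0 ≤ v j)
    (hlinh : ∀ j, Lh j d + h j x = 0)
    (hling : ∀ j, Lg j d + g j x ≥ 0)
    (φ : (Fin n → ℝ) → ℝ)
    (hφ : φ = fun y => f y + ∑ j, ρ j * |h j y| + ∑ j, v j * max 0 (-g j y)) :
    ∃ ℓ : ℝ,
      Tendsto (fun t : ℝ => (φ (x + t • d) - φ x) / t) (𝓝[>] (0 : ℝ)) (𝓝 ℓ) ∧
      ℓ ≤ Lf d - ∑ j, ρ j * |h j x| - ∑ j, v j * max 0 (-g j x) := by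
  have H1 : ∀ j, ∃ ℓ : ℝ, Tendsto (fun t : ℝ => (|h j (x + t • d)| - |h j x|) / t)
      (𝓝[>] (0 : ℝ)) (𝓝 ℓ) ∧ ℓ ≤ -|h j x| := by
    intro j
    have hd := line_aux (hh j) d
    have hj := hlinh j
    obtain ⟨p, hp, hp'⟩ := pos_part_aux _ _ hd (by simp; linarith)
    obtain ⟨q, hq, hq'⟩ := pos_part_aux (fun t => -h j (x + t • d)) _ hd.neg (by simp; linarith)
    simp only [zero_smul, add_zero] at hp hp' hq hq'
    refine ⟨p + q, (hp.add hq).congr fun t => ?_, ?_⟩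
    · rw [abs_eq_aux, abs_eq_aux (h j x)]; ring
    · rw [abs_eq_aux]; linarith
  have H2 : ∀ j, ∃ ℓ : ℝ, Tendsto (fun t : ℝ =>
      (max 0 (-g j (x + t • d)) - max 0 (-g j x)) / t)
      (𝓝[>] (0 : ℝ)) (𝓝 ℓ) ∧ ℓ ≤ -max 0 (-g j x) := by
    intro j
    have hd := line_aux (hg j) d
    have hj := hling j
    obtain ⟨q, hq, hq'⟩ := pos_part_aux (fun t => -g j (x + t • d)) _ hd.neg (by simp; linarith)
    simp only [zero_smul, add_zero] at hq hq'
    exact ⟨q, hq, hq'⟩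
  choose p hp hp' using H1
  choose q hq hq' using H2
  have hs : Tendsto (fun t : ℝ => (f (x + t • d) - f x) / t) (𝓝[>] (0 : ℝ)) (𝓝 (Lf d)) := by
    refine (line_aux hf d).tendsto_slope_zero_right.congr fun t => ?_
    simp [div_eq_inv_mul]
  refine ⟨Lf d + ∑ j, ρ j * p j + ∑ j, v j * q j, ?_, ?_⟩
  · refine ((hs.add (tendsto_finsetSum _ fun j _ => (hp j).const_mul (ρ j))).add
      (tendsto_finsetSum _ fun j _ => (hq j).const_mul (v j))).congr fun t => ?_
    subst hφ
    simp only [← mul_div_assoc, ← Finset.sum_div, mul_sub, Finset.sum_sub_distrib]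
    ring
  · have e1 : ∑ j, ρ j * p j ≤ ∑ j, -(ρ j * |h j x|) := Finset.sum_le_sum fun j _ => by
      have := mul_le_mul_of_nonneg_left (hp' j) (hρ j)
      linarith
    have e2 : ∑ j, v j * q j ≤ ∑ j, -(v j * max 0 (-g j x)) := Finset.sum_le_sum fun j _ => by
      have := mul_le_mul_of_nonneg_left (hq' j) (hv j)
      linarith
    rw [Finset.sum_neg_distrib] at e1 e2
    linarith
end

section
/- Descent property of the SQP search direction for the L1 merit function: let B ∈ ℝ^{n×n} be symmetric positive definite and suppose d ∈ ℝ^n, λ ∈ ℝ^{m_E}, μ ∈ ℝ^{m_I} satisfy the KKT conditions of the QP subproblem (B d + c − A_hᵀλ − A_gᵀμ = 0, A_h d + h = 0, A_g d + g ≥ 0, μ ≥ 0, μᵀ(A_g d + g) = 0). If the penalty parameters satisfy ρ_j ≥ |λ_j| for all j and v_j ≥ μ_j for all j, then cᵀd − Σ_{j=1}^{m_E} ρ_j |h_j| − Σ_{j=1}^{m_I} v_j max(0, −g_j) ≤ −dᵀB d. In particular, if d ≠ 0 this quantity is strictly negative. -/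
open Matrix

/-- Descent property of the SQP search direction for the L1 merit function:
at a KKT point of the QP subproblem with penalty parameters dominating the
multipliers, `Dφ = cᵀd − Σ ρⱼ|hⱼ| − Σ vⱼ max(0, −gⱼ) ≤ −dᵀB d`, which is
strictly negative whenever `d ≠ 0`. -/
theorem sqp_direction_descent (n mE mI : ℕ)
    (B : Matrix (Fin n) (Fin n) ℝ) (hB : B.PosDef)
    (c : Fin n → ℝ)
    (Ah : Matrix (Fin mE) (Fin n) ℝ) (Ag : Matrix (Fin mI) (Fin n) ℝ)
    (h : Fin mE → ℝ) (g : Fin mI → ℝ)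
    (d : Fin n → ℝ) (lam : Fin mE → ℝ) (μ : Fin mI → ℝ)
    (hstat : B.mulVec d + c - Ahᵀ.mulVec lam - Agᵀ.mulVec μ = 0)
    (hfeas_eq : Ah.mulVec d + h = 0)
    (hfeas_ineq : ∀ j, 0 ≤ (Ag.mulVec d + g) j)
    (hμ : ∀ j, 0 ≤ μ j)
    (hcompl : μ ⬝ᵥ (Ag.mulVec d + g) = 0)
    (ρ : Fin mE → ℝ) (v : Fin mI → ℝ)
    (hρ : ∀ j, |lam j| ≤ ρ j) (hv : ∀ j, μ j ≤ v j) :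
    c ⬝ᵥ d - ∑ j, ρ j * |h j| - ∑ j, v j * max 0 (-g j) ≤ -(d ⬝ᵥ B.mulVec d) ∧
    (d ≠ 0 → c ⬝ᵥ d - ∑ j, ρ j * |h j| - ∑ j, v j * max 0 (-g j) < 0) := by
  have h1 : d ⬝ᵥ (B.mulVec d + c - Ahᵀ.mulVec lam - Agᵀ.mulVec μ) = 0 := by
    rw [hstat, dotProduct_zero]
  have h2 : lam ⬝ᵥ (Ah.mulVec d + h) = 0 := by
    rw [hfeas_eq, dotProduct_zero]
  have e1 : d ⬝ᵥ Ahᵀ.mulVec lam = lam ⬝ᵥ Ah.mulVec d := by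
    rw [mulVec_transpose, dotProduct_comm, ← dotProduct_mulVec]
  have e2 : d ⬝ᵥ Agᵀ.mulVec μ = μ ⬝ᵥ Ag.mulVec d := by
    rw [mulVec_transpose, dotProduct_comm, ← dotProduct_mulVec]
  rw [dotProduct_sub, dotProduct_sub, dotProduct_add, e1, e2, dotProduct_comm d c] at h1
  rw [dotProduct_add] at h2 hcompl
  have b1 : -(lam ⬝ᵥ h) ≤ ∑ j, ρ j * |h j| := by
    rw [dotProduct, ← Finset.sum_neg_distrib]
    refine Finset.sum_le_sum fun j _ => ?_
    calc -(lam j * h j) ≤ |lam j * h j| := neg_le_abs _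
      _ = |lam j| * |h j| := abs_mul _ _
      _ ≤ ρ j * |h j| := mul_le_mul_of_nonneg_right (hρ j) (abs_nonneg _)
  have b2 : -(μ ⬝ᵥ g) ≤ ∑ j, v j * max 0 (-g j) := by
    rw [dotProduct, ← Finset.sum_neg_distrib]
    refine Finset.sum_le_sum fun j _ => ?_
    calc -(μ j * g j) = μ j * (-g j) := by ring
      _ ≤ μ j * max 0 (-g j) := mul_le_mul_of_nonneg_left (le_max_right _ _) (hμ j)
      _ ≤ v j * max 0 (-g j) := mul_le_mul_of_nonneg_right (hv j) (le_max_left _ _)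
  have key : c ⬝ᵥ d - ∑ j, ρ j * |h j| - ∑ j, v j * max 0 (-g j) ≤ -(d ⬝ᵥ B.mulVec d) := by
    linarith
  refine ⟨key, fun hd => ?_⟩
  have hp : 0 < d ⬝ᵥ B.mulVec d := by
    simpa using hB.dotProduct_mulVec_pos hd
  linarith
end
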